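/- Let Ω be a differential 2-form of type 4 on a smooth 4-dimensional manifold M with ω_Ω ∧ dω_Ω nowhere vanishing, and set U_Ω = [Z_Ω, T_Ω], V_Ω = [Z_Ω, [Z_Ω, T_Ω]], J(Ω) = φ_Ω(U_Ω). Then Ω(Z_Ω,T_Ω) = 0, Ω(Z_Ω,U_Ω) = 0, Ω(Z_Ω,V_Ω) = J(Ω), Ω(T_Ω,U_Ω) = J(Ω), Ω(T_Ω,V_Ω) = Z_Ω(J(Ω)); consequently (Ω∧Ω)(Z_Ω,T_Ω,U_Ω,V_Ω) = 2·J(Ω)², and at every point where (Z_Ω,T_Ω,U_Ω,V_Ω) are linearly independent, J(Ω) ≠ 0. -/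

import Mathlib

/-!  Coordinate formalization of differential forms in four variables,
     following "The equivalence problem of differential 2-forms in 4 variables". -/

open Real Filter

/-- Points of `ℝ⁴`; the coordinates `x¹, x², x³, x⁴` of the paper are `x 0, x 1, x 2, x 3`. -/
abbrev Pt := Fin 4 → ℝ

/-- Partial derivative `∂f/∂xⁱ`. -/
noncomputable def pd (i : Fin 4) (f : Pt → ℝ) (x : Pt) : ℝ :=
  fderiv ℝ f x (Pi.single i 1)

/-- Second partial derivative `∂²f/∂xⁱ∂xʲ`. -/
noncomputable def pd2 (i j : Fin 4) (f : Pt → ℝ) (x : Pt) : ℝ :=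
  pd i (fun y => pd j f y) x

/-- Differential forms of degree 0,1,2,3,4 on `ℝ⁴`, given by their (skew-symmetric)
    coordinate components, and vector fields. -/
abbrev Form0 := Pt → ℝ
abbrev Form1 := Pt → Fin 4 → ℝ
abbrev Form2 := Pt → Fin 4 → Fin 4 → ℝ
abbrev Form3 := Pt → Fin 4 → Fin 4 → Fin 4 → ℝ
abbrev Form4 := Pt → Fin 4 → Fin 4 → Fin 4 → Fin 4 → ℝ
abbrev Vec := Pt → Fin 4 → ℝ

/-- A 2-form has skew-symmetric components. -/
def Alt2 (B : Form2) : Prop := ∀ x i j, B x i j = - B x j i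

/-- Exterior derivative of a function. -/
noncomputable def d0 (f : Form0) : Form1 := fun x i => pd i f x

/-- Exterior derivative of a 1-form. -/
noncomputable def d1 (ω : Form1) : Form2 := fun x i j =>
  pd i (fun y => ω y j) x - pd j (fun y => ω y i) x

/-- Exterior derivative of a 2-form. -/
noncomputable def d2 (B : Form2) : Form3 := fun x i j k =>
  pd i (fun y => B y j k) x - pd j (fun y => B y i k) x + pd k (fun y => B y i j) x

/-- Wedge product of two 1-forms. -/
def w11 (ω η : Form1) : Form2 := fun x i j => ω x i * η x j - ω x j * η x i

/-- Wedge product of a 1-form and a 2-form. -/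
def w12 (ω : Form1) (B : Form2) : Form3 := fun x i j k =>
  ω x i * B x j k - ω x j * B x i k + ω x k * B x i j

/-- Wedge product of a 1-form and a 3-form. -/
def w13 (ω : Form1) (C : Form3) : Form4 := fun x i j k l =>
  ω x i * C x j k l - ω x j * C x i k l + ω x k * C x i j l - ω x l * C x i j k

/-- Wedge product of two 2-forms. -/
def w22 (A B : Form2) : Form4 := fun x i j k l =>
  A x i j * B x k l - A x i k * B x j l + A x i l * B x j k
    + A x j k * B x i l - A x j l * B x i k + A x k l * B x i j

/-- A 2-form is of rank 4 when `Ω ∧ Ω` vanishes nowhere. -/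
def Rank4 (B : Form2) : Prop := ∀ x, w22 B B x ≠ 0

/-- Interior products `i_X`. -/
def i1 (X : Vec) (ω : Form1) : Form0 := fun x => ∑ i, X x i * ω x i
def i2 (X : Vec) (B : Form2) : Form1 := fun x j => ∑ i, X x i * B x i j
def i3 (X : Vec) (C : Form3) : Form2 := fun x j k => ∑ i, X x i * C x i j k
def i4 (X : Vec) (D : Form4) : Form3 := fun x j k l => ∑ i, X x i * D x i j k l

/-- Evaluation `B(X,Y)` of a 2-form on two vector fields. -/
def ev2 (B : Form2) (X Y : Vec) : Form0 := fun x => ∑ i, ∑ j, X x i * Y x j * B x i j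

/-- Evaluation `D(X,Y,Z,W)` of a 4-form on four vector fields. -/
def ev4 (D : Form4) (X Y Z W : Vec) : Form0 := fun x =>
  ∑ i, ∑ j, ∑ k, ∑ l, X x i * Y x j * Z x k * W x l * D x i j k l

/-- Lie derivative of a 1-form (Cartan's magic formula). -/
noncomputable def lie1 (X : Vec) (ω : Form1) : Form1 := fun x i =>
  d0 (i1 X ω) x i + i2 X (d1 ω) x i

/-- Lie derivative of a 2-form (Cartan's magic formula). -/
noncomputable def lie2 (X : Vec) (B : Form2) : Form2 := fun x i j =>
  d1 (i2 X B) x i j + i3 X (d2 B) x i j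

/-- Lie bracket of two vector fields. -/
noncomputable def bracket (X Y : Vec) : Vec := fun x i =>
  ∑ j, (X x j * pd j (fun y => Y y i) x - Y x j * pd j (fun y => X y i) x)

/-- Derivative `X(f)` of a function along a vector field. -/
noncomputable def dirDeriv (X : Vec) (f : Form0) : Form0 := fun x => ∑ j, X x j * pd j f x

/-- Pullback of a 1-form under a smooth map. -/
noncomputable def pull1 (φ : Pt → Pt) (ω : Form1) : Form1 := fun x i =>
  ∑ a, ω (φ x) a * pd i (fun y => φ y a) x

/-- Pullback of a 2-form under a smooth map. -/
noncomputable def pull2 (φ : Pt → Pt) (B : Form2) : Form2 := fun x i j =>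
  ∑ a, ∑ b, B (φ x) a b * pd i (fun y => φ y a) x * pd j (fun y => φ y b) x

/-- A pair of mutually inverse smooth maps: a diffeomorphism of `ℝ⁴` (with inverse). -/
def IsDiffeo (φ ψ : Pt → Pt) : Prop :=
  ContDiff ℝ (⊤ : ℕ∞) φ ∧ ContDiff ℝ (⊤ : ℕ∞) ψ ∧ (∀ x, ψ (φ x) = x) ∧ (∀ x, φ (ψ x) = x)

/-- The covector with components `c` as a linear functional on the tangent space `ℝ⁴`. -/
noncomputable def covec (c : Fin 4 → ℝ) : Pt →ₗ[ℝ] ℝ :=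
  ∑ i, c i • (LinearMap.proj i : Pt →ₗ[ℝ] ℝ)

/-- The class of a 1-form `ω` at `x`: the codimension of the space of tangent vectors `v`
    with `i_v ω = 0` and `i_v (dω) = 0`. -/
noncomputable def classAt (ω : Form1) (x : Pt) : ℕ :=
  4 - Module.finrank ℝ
    ↥(LinearMap.ker (covec (ω x)) ⊓ ⨅ j, LinearMap.ker (covec (fun i => d1 ω x i j)))

/-- Components of the constant 2-form `dxᵃ ∧ dxᵇ`. -/
def dxw (a b : Fin 4) : Fin 4 → Fin 4 → ℝ := fun i j =>
  (if i = a ∧ j = b then (1:ℝ) else 0) - (if i = b ∧ j = a then (1:ℝ) else 0)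

/-- A germ of 2-form (with associated 1-form `ω = ω_Ω`) is of type `t` at `x₀`:
    `ω` is nonsingular at `x₀` and of constant class `t` near `x₀`. -/
def IsTypeAt (ω : Form1) (t : ℕ) (x₀ : Pt) : Prop :=
  ω x₀ ≠ 0 ∧ ∀ᶠ x in nhds x₀, classAt ω x = t

theorem alg_pf (A B : Fin 4 → Fin 4 → ℝ) (hA : ∀ i j, A i j = - A j i) (hB : ∀ i j, B i j = - B j i)
    (h : A 0 1 * B 2 3 - A 0 2 * B 1 3 + A 0 3 * B 1 2
      + A 1 2 * B 0 3 - A 1 3 * B 0 2 + A 2 3 * B 0 1 = 0) (i j k l : Fin 4) :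
    A i j * B k l - A i k * B j l + A i l * B j k
      + A j k * B i l - A j l * B i k + A k l * B i j = 0 := by
  have a0 : ∀ i, A i i = 0 := fun i => by linarith [hA i i]
  have b0 : ∀ i, B i i = 0 := fun i => by linarith [hB i i]
  have a1 := hA 1 0
  have a2 := hA 2 0
  have a3 := hA 3 0
  have a4 := hA 2 1
  have a5 := hA 3 1
  have a6 := hA 3 2
  have b1 := hB 1 0
  have b2 := hB 2 0
  have b3 := hB 3 0
  have b4 := hB 2 1
  have b5 := hB 3 1
  have b6 := hB 3 2
  clear hA hB
  fin_cases i <;> fin_cases j <;> fin_cases k <;> fin_cases l <;>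
    simp only [Fin.zero_eta, Fin.mk_one, Fin.reduceFinMk, a0, b0, a1, a2, a3, a4, a5, a6,
      b1, b2, b3, b4, b5, b6] <;>
    first | ring1 | linear_combination h | linear_combination -h

theorem alg_pf_self (B : Fin 4 → Fin 4 → ℝ) (hB : ∀ i j, B i j = - B j i)
    (h : B 0 1 * B 2 3 - B 0 2 * B 1 3 + B 0 3 * B 1 2 = 0) (i j k l : Fin 4) :
    B i j * B k l - B i k * B j l + B i l * B j k
      + B j k * B i l - B j l * B i k + B k l * B i j = 0 :=
  alg_pf B B hB hB (by linear_combination 2 * h) i j k l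

theorem alg_inj (B : Fin 4 → Fin 4 → ℝ)
    (hP : B 0 1 * B 2 3 - B 0 2 * B 1 3 + B 0 3 * B 1 2 ≠ 0) (a : Fin 4 → ℝ)
    (h : ∀ i j k, a i * B j k - a j * B i k + a k * B i j = 0) (i : Fin 4) : a i = 0 := by
  have h0 := h 0 1 2
  have h1 := h 0 1 3
  have h2 := h 0 2 3
  have h3 := h 1 2 3
  apply (mul_eq_zero.mp (?_ : (B 0 1 * B 2 3 - B 0 2 * B 1 3 + B 0 3 * B 1 2) * a i = 0)).resolve_left hP
  fin_cases i <;> simp only [Fin.zero_eta, Fin.mk_one, Fin.reduceFinMk]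
  · linear_combination B 0 3 * h0 - B 0 2 * h1 + B 0 1 * h2
  · linear_combination B 1 3 * h0 - B 1 2 * h1 + B 0 1 * h3
  · linear_combination B 2 3 * h0 - B 1 2 * h2 + B 0 2 * h3
  · linear_combination B 2 3 * h1 - B 1 3 * h2 + B 0 3 * h3

theorem alg_thetaZ (B A : Fin 4 → Fin 4 → ℝ) (hB : ∀ i j, B i j = - B j i)
    (hP : B 0 1 * B 2 3 - B 0 2 * B 1 3 + B 0 3 * B 1 2 ≠ 0) (w t z : Fin 4 → ℝ)
    (hw : ∀ j, ∑ i, z i * B i j = w j)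
    (h : ∀ i j k, t i * B j k - t j * B i k + t k * B i j
      = w i * A j k - w j * A i k + w k * A i j) :
    ∑ i, z i * t i = 0 := by
  have b0 : ∀ i, B i i = 0 := fun i => by linarith [hB i i]
  have h0 := h 0 1 2
  have h1 := h 0 1 3
  have h2 := h 0 2 3
  have h3 := h 1 2 3
  apply (mul_eq_zero.mp (?_ : (B 0 1 * B 2 3 - B 0 2 * B 1 3 + B 0 3 * B 1 2) * _ = 0)).resolve_left hP
  have key : w 0 * (t 1 * B 2 3 - t 2 * B 1 3 + t 3 * B 1 2)
     - w 1 * (t 0 * B 2 3 - t 2 * B 0 3 + t 3 * B 0 2)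
     + w 2 * (t 0 * B 1 3 - t 1 * B 0 3 + t 3 * B 0 1)
     - w 3 * (t 0 * B 1 2 - t 1 * B 0 2 + t 2 * B 0 1) = 0 := by
    rw [h0, h1, h2, h3]; ring
  simp only [← hw, Fin.sum_univ_four, b0, hB 1 0, hB 2 0, hB 3 0, hB 2 1, hB 3 1, hB 3 2] at key ⊢
  first | linear_combination key | linear_combination -key

theorem alg_izA (A B : Fin 4 → Fin 4 → ℝ) (w t z : Fin 4 → ℝ)
    (hw : ∀ j, ∑ i, z i * B i j = w j)
    (h : ∀ i j k, t i * B j k - t j * B i k + t k * B i j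
      = w i * A j k - w j * A i k + w k * A i j)
    (hAB : ∀ i j k l, A i j * B k l - A i k * B j l + A i l * B j k
      + A j k * B i l - A j l * B i k + A k l * B i j = 0) (i j k : Fin 4) :
    (∑ m, z m * A m i + t i) * B j k - (∑ m, z m * A m j + t j) * B i k
      + (∑ m, z m * A m k + t k) * B i j = 0 := by
  have h1 := h i j k
  have h2 : ∑ m, z m * (A m i * B j k - A m j * B i k + A m k * B i j
      + A i j * B m k - A i k * B m j + A j k * B m i) = 0 :=
    Finset.sum_eq_zero fun m _ => by rw [hAB, mul_zero]
  simp only [← hw, Fin.sum_univ_four] at h1 h2 ⊢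
  linear_combination h1 + h2

theorem alg_ATU (A B : Fin 4 → Fin 4 → ℝ) (z t u : Fin 4 → ℝ)
    (hAB : ∀ i j k l, A i j * B k l - A i k * B j l + A i l * B j k
      + A j k * B i l - A j l * B i k + A k l * B i j = 0) (l : Fin 4) :
    (∑ i, (∑ j, z j * A j i) * t i) * (∑ k, u k * B k l)
    - (∑ i, (∑ j, z j * A j i) * u i) * (∑ k, t k * B k l)
    + (∑ j, z j * A j l) * (∑ i, (∑ j, t j * B j i) * u i)
    + (∑ i, (∑ j, t j * A j i) * u i) * (∑ k, z k * B k l)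
    - (∑ j, t j * A j l) * (∑ i, (∑ j, z j * B j i) * u i)
    + (∑ j, u j * A j l) * (∑ i, (∑ j, z j * B j i) * t i) = 0 := by
  have h2 : ∑ i, ∑ j, ∑ k, z i * t j * u k * (A i j * B k l - A i k * B j l + A i l * B j k
      + A j k * B i l - A j l * B i k + A k l * B i j) = 0 :=
    Finset.sum_eq_zero fun i _ => Finset.sum_eq_zero fun j _ => Finset.sum_eq_zero fun k _ => by
      rw [hAB, mul_zero]
  simp only [Fin.sum_univ_four] at h2 ⊢
  linear_combination h2

theorem alg_ev4 (B : Fin 4 → Fin 4 → ℝ) (X Y Z W : Fin 4 → ℝ) :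
   ∑ i, ∑ j, ∑ k, ∑ l, X i * Y j * Z k * W l * (B i j * B k l - B i k * B j l + B i l * B j k
    + B j k * B i l - B j l * B i k + B k l * B i j) =
    2 * ((∑ i, ∑ j, X i * Y j * B i j) * (∑ i, ∑ j, Z i * W j * B i j)
      - (∑ i, ∑ j, X i * Z j * B i j) * (∑ i, ∑ j, Y i * W j * B i j)
      + (∑ i, ∑ j, X i * W j * B i j) * (∑ i, ∑ j, Y i * Z j * B i j)) := by
  simp only [Fin.sum_univ_four]
  ring

theorem pd_add' {i : Fin 4} {f g : Pt → ℝ} {x : Pt} (hf : Differentiable ℝ f) (hg : Differentiable ℝ g) :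
    pd i (fun y => f y + g y) x = pd i f x + pd i g x := by
  unfold pd; rw [fderiv_fun_add (hf x) (hg x)]; rfl

theorem pd_sub' {i : Fin 4} {f g : Pt → ℝ} {x : Pt} (hf : Differentiable ℝ f) (hg : Differentiable ℝ g) :
    pd i (fun y => f y - g y) x = pd i f x - pd i g x := by
  unfold pd; rw [fderiv_fun_sub (hf x) (hg x)]; rfl

theorem pd_mul' {i : Fin 4} {f g : Pt → ℝ} {x : Pt} (hf : Differentiable ℝ f) (hg : Differentiable ℝ g) :
    pd i (fun y => f y * g y) x = f x * pd i g x + pd i f x * g x := by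
  unfold pd; rw [fderiv_fun_mul (hf x) (hg x)]; simp [mul_comm]

theorem pd_sum' {i : Fin 4} {f : Fin 4 → Pt → ℝ} {x : Pt} (hf : ∀ j, Differentiable ℝ (f j)) :
    pd i (fun y => ∑ j, f j y) x = ∑ j, pd i (f j) x := by
  unfold pd; rw [fderiv_fun_sum (fun j _ => hf j x)]; simp

theorem pd_zero' {i : Fin 4} {f : Pt → ℝ} {x : Pt} (hf : ∀ y, f y = 0) : pd i f x = 0 := by
  have : f = fun _ => 0 := funext hf
  subst this; simp [pd]

theorem pd_smooth (i : Fin 4) {f : Pt → ℝ} (hf : ContDiff ℝ (⊤ : ℕ∞) f) :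
    ContDiff ℝ (⊤ : ℕ∞) (fun y => pd i f y) := by
  unfold pd
  exact (hf.fderiv_right (m := (⊤ : ℕ∞)) (by simp)).clm_apply contDiff_const

theorem pd_comm' (i j : Fin 4) {f : Pt → ℝ} (hf : ContDiff ℝ (⊤ : ℕ∞) f) (x : Pt) :
    pd i (fun y => pd j f y) x = pd j (fun y => pd i f y) x := by
  have h1 : DifferentiableAt ℝ (fderiv ℝ f) x :=
    ((hf.fderiv_right (m := (⊤ : ℕ∞)) (by simp)).differentiable (by simp)) x
  have hs : IsSymmSndFDerivAt ℝ f x :=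
    (contDiff_infty.1 hf 2).contDiffAt.isSymmSndFDerivAt (by simp)
  have e : ∀ a b : Fin 4, pd a (fun y => pd b f y) x
      = fderiv ℝ (fderiv ℝ f) x (Pi.single a 1) (Pi.single b 1) := by
    intro a b
    unfold pd
    rw [fderiv_clm_apply h1 (differentiableAt_const _)]
    simp
  rw [e, e]; exact hs _ _

theorem bracket_smooth {X Y : Vec} (hX : ∀ i, ContDiff ℝ (⊤ : ℕ∞) (fun y => X y i))
    (hY : ∀ i, ContDiff ℝ (⊤ : ℕ∞) (fun y => Y y i)) (i : Fin 4) :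
    ContDiff ℝ (⊤ : ℕ∞) (fun y => bracket X Y y i) := by
  unfold bracket
  exact ContDiff.sum fun j _ => ((hX j).mul (pd_smooth j (hY i))).sub ((hY j).mul (pd_smooth j (hX i)))

theorem cartan1 {X Y : Vec} {a : Form1} (hX : ∀ i, ContDiff ℝ (⊤ : ℕ∞) (fun y => X y i))
    (hY : ∀ i, ContDiff ℝ (⊤ : ℕ∞) (fun y => Y y i))
    (ha : ∀ i, ContDiff ℝ (⊤ : ℕ∞) (fun y => a y i)) (x : Pt) :
    i1 (bracket X Y) a x = dirDeriv X (i1 Y a) x - dirDeriv Y (i1 X a) x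
      - ∑ i, (∑ j, X x j * d1 a x j i) * Y x i := by
  have dX := fun i => (hX i).differentiable (by simp)
  have dY := fun i => (hY i).differentiable (by simp)
  have da := fun i => (ha i).differentiable (by simp)
  have e : ∀ (W : Vec), (∀ i, Differentiable ℝ (fun y => W y i)) → ∀ j, pd j (i1 W a) x =
      ∑ i, (W x i * pd j (fun y => a y i) x + pd j (fun y => W y i) x * a x i) := by
    intro W hW j
    unfold i1
    rw [pd_sum' (fun i => (hW i).fun_mul (da i))]
    exact Finset.sum_congr rfl fun i _ => pd_mul' (hW i) (da i)
  unfold dirDeriv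
  simp only [e X dX, e Y dY]
  simp only [i1, bracket, d1, Fin.sum_univ_four]
  ring

theorem ddO {Ω : Form2} {ω : Form1} (hΩ : ∀ i j, ContDiff ℝ (⊤ : ℕ∞) (fun y => Ω y i j))
    (hωs : ∀ i, ContDiff ℝ (⊤ : ℕ∞) (fun y => ω y i))
    (hω : ∀ x, w12 ω Ω x = d2 Ω x) (x : Pt) :
    d1 ω x 0 1 * Ω x 2 3 - d1 ω x 0 2 * Ω x 1 3 + d1 ω x 0 3 * Ω x 1 2
      + d1 ω x 1 2 * Ω x 0 3 - d1 ω x 1 3 * Ω x 0 2 + d1 ω x 2 3 * Ω x 0 1 = 0 := by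
  have dΩ := fun i j => (hΩ i j).differentiable (by simp)
  have dω := fun i => (hωs i).differentiable (by simp)
  have dpd := fun k i j => (pd_smooth k (hΩ i j)).differentiable (by simp)
  have e1 : ∀ i j k l, pd i (fun y => w12 ω Ω y j k l) x
      = pd i (fun y => d2 Ω y j k l) x := by
    intro i j k l
    simp only [hω]
  have e2 : ∀ i j k l, pd i (fun y => d2 Ω y j k l) x =
      pd i (fun y => pd j (fun z => Ω z k l) y) x - pd i (fun y => pd k (fun z => Ω z j l) y) x
      + pd i (fun y => pd l (fun z => Ω z j k) y) x := by
    intro i j k l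
    unfold d2
    rw [pd_add' ((dpd _ _ _).fun_sub (dpd _ _ _)) (dpd _ _ _), pd_sub' (dpd _ _ _) (dpd _ _ _)]
  have e3 : ∀ i j k l, pd i (fun y => w12 ω Ω y j k l) x =
      (ω x j * pd i (fun y => Ω y k l) x + pd i (fun y => ω y j) x * Ω x k l)
      - (ω x k * pd i (fun y => Ω y j l) x + pd i (fun y => ω y k) x * Ω x j l)
      + (ω x l * pd i (fun y => Ω y j k) x + pd i (fun y => ω y l) x * Ω x j k) := by
    intro i j k l
    unfold w12
    rw [pd_add' (((dω _).fun_mul (dΩ _ _)).fun_sub ((dω _).fun_mul (dΩ _ _))) ((dω _).fun_mul (dΩ _ _)),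
      pd_sub' ((dω _).fun_mul (dΩ _ _)) ((dω _).fun_mul (dΩ _ _)), pd_mul' (dω _) (dΩ _ _),
      pd_mul' (dω _) (dΩ _ _), pd_mul' (dω _) (dΩ _ _)]
  have f0 := e1 0 1 2 3
  have f1 := e1 1 0 2 3
  have f2 := e1 2 0 1 3
  have f3 := e1 3 0 1 2
  rw [e2, e3] at f0 f1 f2 f3
  have g : ∀ i j k, w12 ω Ω x i j k = d2 Ω x i j k := fun i j k => by rw [hω]
  have g0 := g 1 2 3
  have g1 := g 0 2 3
  have g2 := g 0 1 3
  have g3 := g 0 1 2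
  simp only [w12, d2] at g0 g1 g2 g3
  simp only [d1]
  have c := fun i j k l => pd_comm' i j (hΩ k l) x
  linear_combination f0 - f1 + f2 - f3 - ω x 0 * g0 + ω x 1 * g1 - ω x 2 * g2 + ω x 3 * g3
    + c 0 1 2 3 - c 0 2 1 3 + c 0 3 1 2 + c 1 2 0 3 - c 1 3 0 2 + c 2 3 0 1

theorem dirDeriv_ev2 {X Y W : Vec} {B : Form2}
    (hY : ∀ i, ContDiff ℝ (⊤ : ℕ∞) (fun y => Y y i))
    (hW : ∀ i, ContDiff ℝ (⊤ : ℕ∞) (fun y => W y i))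
    (hB : ∀ i j, ContDiff ℝ (⊤ : ℕ∞) (fun y => B y i j)) (x : Pt) :
    dirDeriv X (ev2 B Y W) x =
      ∑ i, ∑ j, (dirDeriv X (fun y => Y y i) x * W x j * B x i j
        + Y x i * dirDeriv X (fun y => W y j) x * B x i j
        + Y x i * W x j * ∑ k, X x k * pd k (fun y => B y i j) x) := by
  have dY := fun i => (hY i).differentiable (by simp)
  have dW := fun i => (hW i).differentiable (by simp)
  have dB := fun i j => (hB i j).differentiable (by simp)
  have e : ∀ k, pd k (ev2 B Y W) x = ∑ i, ∑ j, (Y x i * W x j * pd k (fun y => B y i j) x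
      + (Y x i * pd k (fun y => W y j) x + pd k (fun y => Y y i) x * W x j) * B x i j) := by
    intro k
    unfold ev2
    rw [pd_sum' (fun i => Differentiable.fun_sum fun j _ => ((dY i).fun_mul (dW j)).fun_mul (dB i j))]
    refine Finset.sum_congr rfl fun i _ => ?_
    rw [pd_sum' (fun j => ((dY i).fun_mul (dW j)).fun_mul (dB i j))]
    refine Finset.sum_congr rfl fun j _ => ?_
    rw [pd_mul' ((dY i).fun_mul (dW j)) (dB i j), pd_mul' (dY i) (dW j)]
  unfold dirDeriv
  simp only [e, Finset.mul_sum]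
  rw [Finset.sum_comm]
  refine Finset.sum_congr rfl fun i _ => ?_
  rw [Finset.sum_comm]
  refine Finset.sum_congr rfl fun j _ => ?_
  simp only [Fin.sum_univ_four]
  ring

theorem bracket_eq (X Y : Vec) (x : Pt) (i : Fin 4) : bracket X Y x i =
    dirDeriv X (fun y => Y y i) x - dirDeriv Y (fun y => X y i) x := by
  simp only [bracket, dirDeriv, Finset.sum_sub_distrib]

theorem alg_cartan2 (X Y W XY YX XW WX YW WY : Fin 4 → ℝ) (B : Fin 4 → Fin 4 → ℝ)
    (hB : ∀ i j, B i j = - B j i) (P : Fin 4 → Fin 4 → Fin 4 → ℝ) :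
    ∑ i, ∑ j, ∑ k, X i * Y j * W k * (P i j k - P j i k + P k i j) =
      (∑ i, ∑ j, (XY i * W j * B i j + Y i * XW j * B i j + Y i * W j * ∑ k, X k * P k i j))
      - (∑ i, ∑ j, (YX i * W j * B i j + X i * YW j * B i j + X i * W j * ∑ k, Y k * P k i j))
      + (∑ i, ∑ j, (WX i * Y j * B i j + X i * WY j * B i j + X i * Y j * ∑ k, W k * P k i j))
      - (∑ i, ∑ j, (XY i - YX i) * W j * B i j)
      - (∑ i, ∑ j, Y i * (XW j - WX j) * B i j)
      + (∑ i, ∑ j, X i * (YW j - WY j) * B i j) := by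
  have b0 : ∀ i, B i i = 0 := fun i => by linarith [hB i i]
  simp only [Fin.sum_univ_four, b0, hB 1 0, hB 2 0, hB 3 0, hB 2 1, hB 3 1, hB 3 2]
  ring

theorem cartan2 {X Y W : Vec} {B : Form2} (hX : ∀ i, ContDiff ℝ (⊤ : ℕ∞) (fun y => X y i))
    (hY : ∀ i, ContDiff ℝ (⊤ : ℕ∞) (fun y => Y y i))
    (hW : ∀ i, ContDiff ℝ (⊤ : ℕ∞) (fun y => W y i))
    (hB : ∀ i j, ContDiff ℝ (⊤ : ℕ∞) (fun y => B y i j)) (hBa : Alt2 B) (x : Pt) :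
    ∑ i, ∑ j, ∑ k, X x i * Y x j * W x k * d2 B x i j k =
      dirDeriv X (ev2 B Y W) x - dirDeriv Y (ev2 B X W) x + dirDeriv W (ev2 B X Y) x
      - ev2 B (bracket X Y) W x - ev2 B Y (bracket X W) x + ev2 B X (bracket Y W) x := by
  rw [dirDeriv_ev2 hY hW hB, dirDeriv_ev2 hX hW hB, dirDeriv_ev2 hX hY hB]
  simp only [ev2, bracket_eq, d2]
  exact alg_cartan2 _ _ _ _ _ _ _ _ _ _ (hBa x) (fun k i j => pd k (fun y => B y i j) x)

/-- from Theorem `TheBasis`. For a 2-form `Ω` of type 4, with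
`U_Ω = [Z_Ω,T_Ω]`, `V_Ω = [Z_Ω,[Z_Ω,T_Ω]]` and `J(Ω) = φ_Ω(U_Ω)`, the matrix of `Ω` in
`(Z_Ω,T_Ω,U_Ω,V_Ω)` is as computed in the paper; in particular
`(Ω∧Ω)(Z_Ω,T_Ω,U_Ω,V_Ω) = 2·J(Ω)²`, and `J(Ω) ≠ 0` wherever the four fields are
linearly independent. -/
theorem matrix_of_Omega_in_frame (Ω : Form2) (hΩs : ContDiff ℝ (⊤ : ℕ∞) Ω) (hΩa : Alt2 Ω)
    (hΩr : Rank4 Ω)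
    (ω : Form1) (hωs : ContDiff ℝ (⊤ : ℕ∞) ω) (hω : ∀ x, w12 ω Ω x = d2 Ω x)
    (θ : Form1) (hθs : ContDiff ℝ (⊤ : ℕ∞) θ) (hθ : ∀ x, w12 θ Ω x = w12 ω (d1 ω) x)
    (Z : Vec) (hZs : ContDiff ℝ (⊤ : ℕ∞) Z) (hZ : ∀ x, i2 Z Ω x = ω x)
    (T : Vec) (hTs : ContDiff ℝ (⊤ : ℕ∞) T) (hT : ∀ x, i2 T Ω x = θ x)
    (htype4 : ∀ x, ω x ≠ 0 ∧ classAt ω x = 4)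
    (hnv : ∀ x, w12 ω (d1 ω) x ≠ 0)
    (Uv Vv : Vec) (hU : Uv = bracket Z T) (hV : Vv = bracket Z Uv)
    (J : Form0) (hJ : ∀ x, J x = i1 Uv θ x) :
    (∀ x, ev2 Ω Z T x = 0) ∧
    (∀ x, ev2 Ω Z Uv x = 0) ∧
    (∀ x, ev2 Ω Z Vv x = J x) ∧
    (∀ x, ev2 Ω T Uv x = J x) ∧
    (∀ x, ev2 Ω T Vv x = dirDeriv Z J x) ∧
    (∀ x, ev4 (w22 Ω Ω) Z T Uv Vv x = 2 * (J x) ^ 2) ∧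
    (∀ x, LinearIndependent ℝ ![Z x, T x, Uv x, Vv x] → J x ≠ 0) := by
  have sΩ : ∀ i j, ContDiff ℝ (⊤ : ℕ∞) (fun y => Ω y i j) := fun i j =>
    contDiff_pi.1 (contDiff_pi.1 hΩs i) j
  have sω : ∀ i, ContDiff ℝ (⊤ : ℕ∞) (fun y => ω y i) := contDiff_pi.1 hωs
  have sθ : ∀ i, ContDiff ℝ (⊤ : ℕ∞) (fun y => θ y i) := contDiff_pi.1 hθs
  have sZ : ∀ i, ContDiff ℝ (⊤ : ℕ∞) (fun y => Z y i) := contDiff_pi.1 hZs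
  have sT : ∀ i, ContDiff ℝ (⊤ : ℕ∞) (fun y => T y i) := contDiff_pi.1 hTs
  have sU : ∀ i, ContDiff ℝ (⊤ : ℕ∞) (fun y => Uv y i) := by
    rw [hU]; exact bracket_smooth sZ sT
  have dd0 : ∀ (X : Vec) (f : Form0), (∀ y, f y = 0) → ∀ x, dirDeriv X f x = 0 := by
    intro X f hf x
    simp only [dirDeriv, pd_zero' hf, mul_zero, Finset.sum_const_zero]
  have Aalt : ∀ x i j, d1 ω x i j = - d1 ω x j i := by
    intro x i j; simp only [d1]; ring
  have hZ' : ∀ x j, ∑ i, Z x i * Ω x i j = ω x j := fun x j => congrFun (hZ x) j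
  have hT' : ∀ x j, ∑ i, T x i * Ω x i j = θ x j := fun x j => congrFun (hT x) j
  have hP : ∀ x, Ω x 0 1 * Ω x 2 3 - Ω x 0 2 * Ω x 1 3 + Ω x 0 3 * Ω x 1 2 ≠ 0 := by
    intro x h
    apply hΩr x
    funext i j k l
    exact alg_pf_self (Ω x) (hΩa x) h i j k l
  have hAB : ∀ x i j k l, d1 ω x i j * Ω x k l - d1 ω x i k * Ω x j l + d1 ω x i l * Ω x j k
      + d1 ω x j k * Ω x i l - d1 ω x j l * Ω x i k + d1 ω x k l * Ω x i j = 0 := fun x =>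
    alg_pf (d1 ω x) (Ω x) (Aalt x) (hΩa x) (ddO sΩ sω hω x)
  have hθ' : ∀ x i j k, θ x i * Ω x j k - θ x j * Ω x i k + θ x k * Ω x i j
      = ω x i * d1 ω x j k - ω x j * d1 ω x i k + ω x k * d1 ω x i j := fun x i j k =>
    congrFun (congrFun (congrFun (hθ x) i) j) k
  have izA : ∀ x i, ∑ m, Z x m * d1 ω x m i = - θ x i := fun x i =>
    eq_neg_of_add_eq_zero_left (alg_inj (Ω x) (hP x) (fun i => ∑ m, Z x m * d1 ω x m i + θ x i)
      (alg_izA (d1 ω x) (Ω x) (ω x) (θ x) (Z x) (hZ' x) (hθ' x) (hAB x)) i)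
  -- evaluations of `Ω` through `ω` and `θ`
  have evgen : ∀ (X Y : Vec) x, ev2 Ω X Y x = ∑ j, (∑ i, X x i * Ω x i j) * Y x j := by
    intro X Y x
    simp only [ev2, Fin.sum_univ_four]; ring
  have evZ : ∀ (Y : Vec) x, ev2 Ω Z Y x = i1 Y ω x := by
    intro Y x
    rw [evgen]; simp only [hZ', i1]; exact Finset.sum_congr rfl fun i _ => mul_comm _ _
  have evT : ∀ (Y : Vec) x, ev2 Ω T Y x = i1 Y θ x := by
    intro Y x
    rw [evgen]; simp only [hT', i1]; exact Finset.sum_congr rfl fun i _ => mul_comm _ _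
  have evskew : ∀ (X Y : Vec) x, ev2 Ω X Y x = - ev2 Ω Y X x := by
    intro X Y x
    have b0 : ∀ i, Ω x i i = 0 := fun i => by linarith [hΩa x i i]
    simp only [ev2, Fin.sum_univ_four, b0, hΩa x 1 0, hΩa x 2 0, hΩa x 3 0, hΩa x 2 1,
      hΩa x 3 1, hΩa x 3 2]
    ring
  have θZ : ∀ x, i1 Z θ x = 0 := fun x =>
    alg_thetaZ (Ω x) (d1 ω x) (hΩa x) (hP x) (ω x) (θ x) (Z x) (hZ' x) (hθ' x)
  have ωZ : ∀ x, i1 Z ω x = 0 := fun x => by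
    have := evskew Z Z x
    rw [← evZ]; linarith
  have θT : ∀ x, i1 T θ x = 0 := fun x => by
    have := evskew T T x
    rw [← evT]; linarith
  have ωT : ∀ x, i1 T ω x = 0 := fun x => by
    rw [← evZ, evskew, evT, θZ, neg_zero]
  have AZ : ∀ (Y : Vec) x, ∑ i, (∑ j, Z x j * d1 ω x j i) * Y x i = - i1 Y θ x := by
    intro Y x
    simp only [izA, i1, neg_mul, Finset.sum_neg_distrib]
    exact congrArg Neg.neg (Finset.sum_congr rfl fun i _ => mul_comm _ _)
  have ωU : ∀ x, i1 Uv ω x = 0 := fun x => by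
    rw [hU, cartan1 sZ sT sω, dd0 Z _ ωT, dd0 T _ ωZ, AZ, θT]; ring
  have ωV : ∀ x, i1 Vv ω x = J x := fun x => by
    rw [hV, cartan1 sZ sU sω, dd0 Z _ ωU, dd0 Uv _ ωZ, AZ, hJ]; ring
  have ATU : ∀ x, ∑ i, (∑ j, T x j * d1 ω x j i) * Uv x i = 0 := by
    intro x
    obtain ⟨l, hl⟩ := Function.ne_iff.1 (htype4 x).1
    have h := alg_ATU (d1 ω x) (Ω x) (Z x) (T x) (Uv x) (hAB x) l
    rw [AZ T, AZ Uv, θT, izA, ← evgen T Uv, ← evgen Z Uv, ← evgen Z T, hT', hZ', evT, evZ, evZ,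
      ωT, ωU] at h
    exact (mul_eq_zero.1 (by linear_combination h :
      (∑ i, (∑ j, T x j * d1 ω x j i) * Uv x i) * ω x l = 0)).resolve_right hl
  have ωTU : ∀ x, i1 (bracket T Uv) ω x = 0 := fun x => by
    rw [cartan1 sT sU sω, dd0 T _ ωU, dd0 Uv _ ωT, ATU]; ring
  have e1 : ∀ x, ev2 Ω Z T x = 0 := fun x => by rw [evZ, ωT]
  have e2 : ∀ x, ev2 Ω Z Uv x = 0 := fun x => by rw [evZ, ωU]
  have e3 : ∀ x, ev2 Ω Z Vv x = J x := fun x => by rw [evZ, ωV]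
  have e4 : ∀ x, ev2 Ω T Uv x = J x := fun x => by rw [evT, hJ]
  have e5 : ∀ x, ev2 Ω T Vv x = dirDeriv Z J x := by
    intro x
    have h := cartan2 sZ sT sU sΩ hΩa x
    have h0 : ∑ i, ∑ j, ∑ k, Z x i * T x j * Uv x k * d2 Ω x i j k = 0 := by
      have : ∑ i, ∑ j, ∑ k, Z x i * T x j * Uv x k * d2 Ω x i j k =
          i1 Z ω x * ev2 Ω T Uv x - i1 T ω x * ev2 Ω Z Uv x + i1 Uv ω x * ev2 Ω Z T x := by
        simp only [← hω, w12, i1, ev2, Fin.sum_univ_four]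
        ring
      rw [this, ωZ, ωT, ωU]; ring
    have hJ4 : ev2 Ω T Uv = J := funext e4
    have hUU : ev2 Ω Uv Uv x = 0 := by linarith [evskew Uv Uv x]
    rw [h0, dd0 T _ e2, dd0 Uv _ e1, ← hU, ← hV, hUU, hJ4, evZ (bracket T Uv), ωTU] at h
    linarith
  refine ⟨e1, e2, e3, e4, e5, ?_, ?_⟩
  · intro x
    have h := alg_ev4 (Ω x) (Z x) (T x) (Uv x) (Vv x)
    have h' : ev4 (w22 Ω Ω) Z T Uv Vv x = 2 * (ev2 Ω Z T x * ev2 Ω Uv Vv x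
      - ev2 Ω Z Uv x * ev2 Ω T Vv x + ev2 Ω Z Vv x * ev2 Ω T Uv x) := h
    rw [h', e1, e2, e3, e4]; ring
  · intro x hli hJ0
    apply (htype4 x).1
    have hspan := hli.span_eq_top_of_card_eq_finrank (by simp)
    let f : Pt →ₗ[ℝ] ℝ := covec (ω x)
    have hf : ∀ v, f v = ∑ i, v i * ω x i := by
      intro v
      simp [f, covec, mul_comm]
    have f0 : f = 0 := by
      apply LinearMap.ext_on_range hspan
      intro i
      rw [hf]
      fin_cases i
      · exact ωZ x
      · exact ωT x
      · exact ωU x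
      · exact (ωV x).trans hJ0
    funext i
    have := hf (Pi.single i 1)
    rw [f0] at this
    simpa [Pi.single_apply] using this.symm
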